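/- Let K be a finite field and a_0, …, a_m ∈ K with a_0 ≠ 0. Then there exist infinitely many n ≥ m and coefficients a_{m+1}, …, a_n ∈ K such that the polynomial Σ_{i=0}^{n} a_i X^i is irreducible in K[X]. -/

import Mathlib

open Polynomial

namespace Dir
noncomputable section
open Classical Finset

lemma monFin (K : Type*) [Field K] [Fintype K] (n : ℕ) :
    {f : K[X] | f.natDegree ≤ n}.Finite := by
  have : Finite (degreeLT K (n+1)) := Finite.of_equiv _ (degreeLTEquiv K (n+1)).toEquiv.symm
  refine Set.Finite.subset (Set.toFinite (degreeLT K (n+1) : Set K[X])) ?_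
  intro f hf
  simp only [SetLike.mem_coe, mem_degreeLT]
  exact lt_of_le_of_lt degree_le_natDegree (by exact_mod_cast Nat.lt_succ_of_le hf)

variable (K : Type*) [Field K] [Fintype K]

def Le (n : ℕ) : Finset K[X] := (monFin K n).toFinset
def Mon (n : ℕ) : Finset K[X] := (Le K n).filter (fun f => f.Monic ∧ f.natDegree = n)
def Irr (n : ℕ) : Finset K[X] := (Le K n).filter (fun f => f.Monic ∧ Irreducible f)

variable {K}
lemma mem_Mon {n : ℕ} {f : K[X]} : f ∈ Mon K n ↔ f.Monic ∧ f.natDegree = n := by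
  simp only [Mon, Le, mem_filter, Set.Finite.mem_toFinset, Set.mem_ofPred_eq]
  constructor
  · exact fun h => h.2
  · exact fun h => ⟨h.2.le, h⟩

lemma mem_Irr {n : ℕ} {f : K[X]} : f ∈ Irr K n ↔ f.Monic ∧ Irreducible f ∧ f.natDegree ≤ n := by
  simp only [Irr, Le, mem_filter, Set.Finite.mem_toFinset, Set.mem_ofPred_eq]
  tauto

lemma card_Le (n : ℕ) : #(Le K n) = Fintype.card K ^ (n+1) := by
  have : Finite (degreeLT K (n+1)) := Finite.of_equiv _ (degreeLTEquiv K (n+1)).toEquiv.symm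
  have h : Nat.card (degreeLT K (n+1)) = Fintype.card K ^ (n+1) := by
    rw [Nat.card_congr (degreeLTEquiv K (n+1)).toEquiv]; simp
  rw [← h, ← Nat.card_eq_finsetCard]
  refine Nat.card_congr (Equiv.subtypeEquivRight fun f => ?_)
  rw [mem_degreeLT, Le, Set.Finite.mem_toFinset]
  change f.natDegree ≤ n ↔ _
  rw [natDegree_le_iff_degree_le, degree_le_iff_coeff_zero, degree_lt_iff_coeff_zero]
  exact forall_congr' fun k => by rw [Nat.cast_lt, Nat.succ_le_iff]

lemma card_Mon (n : ℕ) : #(Mon K n) = Fintype.card K ^ n := by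
  have h : Nat.card {p : K[X] // p.Monic ∧ p.natDegree = n} = Fintype.card K ^ n := by
    rw [Nat.card_congr ((monicEquivDegreeLT n).trans (degreeLTEquiv K n).toEquiv)]; simp
  rw [← h, ← Nat.card_eq_finsetCard]
  exact Nat.card_congr (Equiv.subtypeEquivRight fun f => mem_Mon)

lemma mangoldt {n : ℕ} {f : K[X]} (hf : f ∈ Mon K n) :
    ∑ x ∈ Irr K n ×ˢ Icc 1 n, (if x.1 ^ x.2 ∣ f then x.1.natDegree else 0) = n := by
  obtain ⟨hm, hd⟩ := mem_Mon.1 hf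
  have hf0 : f ≠ 0 := hm.ne_zero
  set s := UniqueFactorizationMonoid.normalizedFactors f with hs
  have hsm : ∀ P ∈ s, P.Monic ∧ Irreducible P := by
    intro P hP
    have hi := UniqueFactorizationMonoid.irreducible_of_normalized_factor P hP
    refine ⟨?_, hi⟩
    have := UniqueFactorizationMonoid.normalize_normalized_factor P hP
    rw [← this]
    exact monic_normalize hi.ne_zero
  have hprod : s.prod = f := by
    have h1 := UniqueFactorizationMonoid.prod_normalizedFactors hf0
    have h2 := monic_multiset_prod_of_monic s id (fun P hP => (hsm P hP).1)
    rw [Multiset.map_id] at h2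
    exact eq_of_monic_of_associated h2 hm h1
  have hdeg : (s.map natDegree).sum = n := by
    rw [← hd, ← natDegree_multiset_prod_of_monic _ (fun P hP => (hsm P hP).1), hprod]
  have hsub : s.toFinset ⊆ Irr K n := by
    intro P hP
    have hP' := Multiset.mem_toFinset.1 hP
    refine mem_Irr.2 ⟨(hsm P hP').1, (hsm P hP').2, ?_⟩
    rw [← hd]
    exact natDegree_le_of_dvd (UniqueFactorizationMonoid.dvd_of_mem_normalizedFactors hP') hf0
  have hinner : ∀ P ∈ Irr K n, ∑ j ∈ Icc 1 n, (if P ^ j ∣ f then P.natDegree else 0)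
      = s.count P * P.natDegree := by
    intro P hP
    obtain ⟨hPm, hPi, hPd⟩ := mem_Irr.1 hP
    have hiff : ∀ j, P ^ j ∣ f ↔ j ≤ s.count P := by
      intro j
      rw [pow_dvd_iff_le_emultiplicity,
        UniqueFactorizationMonoid.emultiplicity_eq_count_normalizedFactors hPi hf0,
        hPm.normalize_eq_self]
      exact_mod_cast Iff.rfl
    rw [← Finset.sum_filter, Finset.sum_const, smul_eq_mul]
    congr 1
    have : (Icc 1 n).filter (fun j => P ^ j ∣ f) = Icc 1 (s.count P) := by
      ext j
      simp only [mem_filter, mem_Icc, hiff]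
      constructor
      · tauto
      · rintro ⟨h1, h2⟩
        refine ⟨⟨h1, ?_⟩, h2⟩
        have h3 := natDegree_le_of_dvd ((hiff j).2 h2) hf0
        rw [natDegree_pow, hd] at h3
        have := hPi.natDegree_pos
        nlinarith
    rw [this]; simp
  rw [Finset.sum_product, Finset.sum_congr rfl hinner]
  refine Eq.trans ?_ hdeg
  rw [Finset.sum_multiset_map_count]
  symm
  apply Finset.sum_subset hsub
  intro P _ hP
  rw [Multiset.mem_toFinset] at hP
  simp [Multiset.count_eq_zero_of_notMem hP]

def A (ψ : K[X] →* ℂ) (n : ℕ) : ℂ := ∑ f ∈ Mon K n, ψ f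
def lam (ψ : K[X] →* ℂ) (n : ℕ) : ℂ := ∑ x ∈ Irr K n ×ˢ Icc 1 n,
  if x.2 * x.1.natDegree = n then (x.1.natDegree : ℂ) * ψ (x.1 ^ x.2) else 0

lemma lam_eq (ψ : K[X] →* ℂ) {k n : ℕ} (h : k ≤ n) : lam ψ k = ∑ x ∈ Irr K n ×ˢ Icc 1 n,
    if x.2 * x.1.natDegree = k then (x.1.natDegree : ℂ) * ψ (x.1 ^ x.2) else 0 := by
  apply Finset.sum_subset
  · intro x hx
    simp only [mem_product, mem_Irr, mem_Icc] at hx ⊢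
    exact ⟨⟨hx.1.1, hx.1.2.1, by lia⟩, by lia⟩
  · intro x hx hx'
    simp only [mem_product, mem_Irr, mem_Icc] at hx hx'
    rw [if_neg]
    intro h
    apply hx'
    have := hx.1.2.1.natDegree_pos
    refine ⟨⟨hx.1.1, hx.1.2.1, ?_⟩, hx.2.1, ?_⟩ <;> nlinarith

lemma sum_dvd (ψ : K[X] →* ℂ) {n : ℕ} {g : K[X]} (hg : g.Monic) :
    ∑ f ∈ Mon K n, (if g ∣ f then ψ f else 0) =
      if g.natDegree ≤ n then ψ g * A ψ (n - g.natDegree) else 0 := by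
  split_ifs with h
  · rw [A, Finset.mul_sum, ← Finset.sum_filter]
    symm
    apply Finset.sum_bij (fun f _ => g * f)
    · intro f hf
      obtain ⟨h1, h2⟩ := mem_Mon.1 hf
      rw [mem_filter, mem_Mon]
      exact ⟨⟨hg.mul h1, by rw [hg.natDegree_mul h1]; lia⟩, dvd_mul_right _ _⟩
    · intro a _ b _ hab
      exact mul_left_cancel₀ hg.ne_zero hab
    · intro f hf
      rw [mem_filter, mem_Mon] at hf
      obtain ⟨⟨h1, h2⟩, c, rfl⟩ := hf
      have hc : c.Monic := hg.of_mul_monic_left h1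
      refine ⟨c, mem_Mon.2 ⟨hc, ?_⟩, rfl⟩
      rw [hg.natDegree_mul hc] at h2; lia
    · intro f _
      rw [map_mul]
  · apply Finset.sum_eq_zero
    intro f hf
    obtain ⟨h1, h2⟩ := mem_Mon.1 hf
    rw [if_neg]
    intro hd
    exact h (h2 ▸ natDegree_le_of_dvd hd h1.ne_zero)

lemma recur (ψ : K[X] →* ℂ) (n : ℕ) :
    (n : ℂ) * A ψ n = ∑ x ∈ antidiagonal n, lam ψ x.1 * A ψ x.2 := by
  have e1 : (n : ℂ) * A ψ n = ∑ f ∈ Mon K n, ∑ x ∈ Irr K n ×ˢ Icc 1 n,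
      (x.1.natDegree : ℂ) * (if x.1 ^ x.2 ∣ f then ψ f else 0) := by
    rw [A, Finset.mul_sum]
    refine Finset.sum_congr rfl fun f hf => ?_
    have h := congrArg (Nat.cast : ℕ → ℂ) (mangoldt hf)
    rw [← h, Nat.cast_sum, Finset.sum_mul]
    refine Finset.sum_congr rfl fun x _ => ?_
    split_ifs <;> simp
  rw [e1, Finset.sum_comm, Finset.Nat.sum_antidiagonal_eq_sum_range_succ_mk]
  have e2 : ∀ k ∈ range n.succ, lam ψ k * A ψ (n - k) = ∑ x ∈ Irr K n ×ˢ Icc 1 n,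
      if x.2 * x.1.natDegree = k then (x.1.natDegree : ℂ) * ψ (x.1 ^ x.2) * A ψ (n - k) else 0 := by
    intro k hk
    rw [lam_eq ψ (Nat.lt_succ_iff.1 (mem_range.1 hk)), Finset.sum_mul]
    refine Finset.sum_congr rfl fun x _ => ?_
    split_ifs <;> simp
  rw [Finset.sum_congr rfl e2]
  conv_rhs => rw [Finset.sum_comm]
  refine Finset.sum_congr rfl fun x hx => ?_
  have hm : x.1.Monic := (mem_Irr.1 (mem_product.1 hx).1).1
  rw [← Finset.mul_sum, sum_dvd ψ (hm.pow _), Finset.sum_ite_eq, hm.natDegree_pow]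
  simp only [mem_range, Nat.lt_succ_iff]
  split_ifs
  · ring
  · simp

section PS
open PowerSeries (derivative)

lemma logder {ι : Type*} (L F : ι → PowerSeries ℂ)
    (hL : ∀ i, PowerSeries.X * derivative ℂ (L i) = F i * L i) (s : Finset ι) :
    PowerSeries.X * derivative ℂ (∏ i ∈ s, L i) = (∑ i ∈ s, F i) * ∏ i ∈ s, L i := by
  induction s using Finset.induction_on with
  | empty => simp
  | insert a s ha ih =>
    rw [prod_insert ha, sum_insert ha, Derivation.leibniz, smul_eq_mul, smul_eq_mul]
    linear_combination (L a) * ih + (∏ i ∈ s, L i) * hL a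

open scoped ComplexOrder in
lemma pos_coeff (P G : PowerSeries ℂ) (h0 : PowerSeries.constantCoeff P = 1)
    (hP : PowerSeries.X * derivative ℂ P = G * P) (hG : ∀ n, 0 ≤ PowerSeries.coeff n G) (n : ℕ) :
    0 ≤ PowerSeries.coeff n P ∧ (0 < n → 0 < PowerSeries.coeff n G → 0 < PowerSeries.coeff n P) := by
  induction n using Nat.strong_induction_on with
  | _ n ih =>
    rcases Nat.eq_zero_or_pos n with rfl | hn
    · simp [h0]
    have h := congrArg (PowerSeries.coeff n) hP
    obtain ⟨k, rfl⟩ : ∃ k, n = k + 1 := ⟨n - 1, by lia⟩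
    rw [PowerSeries.coeff_succ_X_mul, PowerSeries.coeff_derivative, PowerSeries.coeff_mul] at h
    have hc0 : PowerSeries.coeff 0 G = 0 := by
      have := congrArg (PowerSeries.coeff 0) hP
      simpa [h0] using this.symm
    have hterm : ∀ x ∈ antidiagonal (k+1),
        0 ≤ PowerSeries.coeff x.1 G * PowerSeries.coeff x.2 P := by
      intro x hx
      rw [HasAntidiagonal.mem_antidiagonal] at hx
      rcases Nat.eq_zero_or_pos x.1 with h1 | h1
      · rw [h1, hc0, zero_mul]
      · exact mul_nonneg (hG _) (ih x.2 (by lia)).1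
    have hk0 : (k : ℂ) + 1 ≠ 0 := by exact_mod_cast Nat.succ_ne_zero k
    have hk : (0 : ℂ) < ((k : ℂ) + 1)⁻¹ := by
      have h1 : (0 : ℝ) < ((k : ℝ) + 1)⁻¹ := by positivity
      have h2 := Complex.zero_lt_real.2 h1
      simpa using h2
    have hval : ∀ z : ℂ, z = (z * ((k : ℂ) + 1)) * ((k : ℂ) + 1)⁻¹ := fun z => by
      rw [mul_assoc, mul_inv_cancel₀ hk0, mul_one]
    constructor
    · have := sum_nonneg hterm
      rw [← h] at this
      rw [hval (PowerSeries.coeff (k+1) P)]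
      exact mul_nonneg this hk.le
    · intro _ hpos
      have : 0 < ∑ x ∈ antidiagonal (k+1), PowerSeries.coeff x.1 G * PowerSeries.coeff x.2 P := by
        refine sum_pos' hterm ⟨(k+1, 0), by simp, ?_⟩
        simpa [h0] using hpos
      rw [← h] at this
      rw [hval (PowerSeries.coeff (k+1) P)]
      exact mul_pos this hk

lemma eval_mul_ps (f : PowerSeries ℂ) (g h : ℂ[X]) (r : ℂ) (hfg : (g : PowerSeries ℂ) * f = h)
    (hs : Summable fun n => ‖PowerSeries.coeff n f * r ^ n‖) (hg : g.eval r = 0) :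
    h.eval r = 0 := by
  have hpoly : ∀ g : ℂ[X], HasSum (fun n => g.coeff n * r ^ n) (g.eval r) := by
    intro g
    rw [eval_eq_sum, sum_def]
    apply hasSum_sum_of_ne_finset_zero
    intro b hb
    rw [notMem_support_iff.1 hb, zero_mul]
  have hsum : Summable fun n => ‖g.coeff n * r ^ n‖ := by
    apply summable_of_ne_finset_zero (s := g.support)
    intro b hb
    rw [notMem_support_iff.1 hb, zero_mul, norm_zero]
  have := tsum_mul_tsum_eq_tsum_sum_antidiagonal_of_summable_norm hsum hs
  rw [(hpoly g).tsum_eq, hg, zero_mul] at this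
  rw [← (hpoly h).tsum_eq, this]
  congr 1
  ext n
  rw [← coeff_coe, ← hfg, PowerSeries.coeff_mul, sum_mul]
  refine sum_congr rfl fun x hx => ?_
  rw [← HasAntidiagonal.mem_antidiagonal.1 hx, coeff_coe, pow_add]; ring

open scoped ComplexOrder in
lemma main_ps {ι : Type*} [Fintype ι] (i0 : ι) (q : ℂ) (hq : q ≠ 0) (L F : ι → PowerSeries ℂ)
    (hL : ∀ i, PowerSeries.X * derivative ℂ (L i) = F i * L i)
    (h0 : ∀ i, PowerSeries.constantCoeff (L i) = 1) (p : ι → ℂ[X])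
    (hp : ∀ i, i ≠ i0 → L i = p i) (W : ℂ[X])
    (hW : ((1 - C q * X : ℂ[X]) : PowerSeries ℂ) * L i0 = W) (hW0 : W.eval q⁻¹ ≠ 0)
    (hF : ∀ n, 0 ≤ PowerSeries.coeff n (∑ i, F i))
    (hF' : ∀ N, ∃ n, N ≤ n ∧ 0 < PowerSeries.coeff n (∑ i, F i))
    (c : ι → ℂ) (hc : c i0 = 1)
    (hs : Summable fun n => ‖PowerSeries.coeff n (∑ i, PowerSeries.C (c i) * F i) * q⁻¹ ^ n‖) :
    False := by
  set s := (univ : Finset ι).erase i0 with hsdef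
  set Q : ℂ[X] := ∏ i ∈ s, p i with hQdef
  have hQ : ∏ i ∈ s, L i = (Q : PowerSeries ℂ) := by
    rw [hQdef, ← Polynomial.coeToPowerSeries.ringHom_apply, map_prod]
    exact prod_congr rfl fun i hi => hp i (ne_of_mem_erase hi)
  have hl0 : (1 - C q * X : ℂ[X]).eval q⁻¹ = 0 := by simp [hq]
  -- nonvanishing
  have hQ0 : Q.eval q⁻¹ ≠ 0 := by
    intro hz
    have hdvd : (1 - C q * X : ℂ[X]) ∣ Q := by
      have h1 : (X - C q⁻¹ : ℂ[X]) ∣ Q := dvd_iff_isRoot.2 hz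
      have h2 : (1 - C q * X : ℂ[X]) = C (-q) * (X - C q⁻¹) := by
        rw [mul_sub, ← C_mul]; simp [hq]; ring
      rw [h2]
      exact (isUnit_C.2 (isUnit_iff_ne_zero.2 (neg_ne_zero.2 hq))).mul_left_dvd.2 h1
    obtain ⟨Q', hQ'⟩ := hdvd
    have hP : ∏ i, L i = ((W * Q' : ℂ[X]) : PowerSeries ℂ) := by
      rw [← mul_prod_erase univ L (mem_univ i0), hQ, hQ', Polynomial.coe_mul, Polynomial.coe_mul, ← hW]; ring
    obtain ⟨n, hn, hpos⟩ := hF' ((W * Q').natDegree + 1)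
    have h3 := (pos_coeff (∏ i, L i) (∑ i, F i) (by rw [map_prod]; simp [h0])
      (logder L F hL univ) hF n).2 (by lia) hpos
    rw [hP, coeff_coe, coeff_eq_zero_of_natDegree_lt (by lia)] at h3
    exact lt_irrefl _ h3
  -- the remainder
  have hR : ∃ R : ℂ[X], (∑ i ∈ s, PowerSeries.C (c i) * F i) * (Q : PowerSeries ℂ) = R := by
    refine ⟨∑ i ∈ s, C (c i) * (X * Polynomial.derivative (p i)) * ∏ j ∈ s.erase i, p j, ?_⟩
    rw [sum_mul, ← Polynomial.coeToPowerSeries.ringHom_apply (φ := ∑ i ∈ s, _), map_sum]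
    refine sum_congr rfl fun i hi => ?_
    rw [hQdef, ← mul_prod_erase s p hi, Polynomial.coeToPowerSeries.ringHom_apply]
    simp only [Polynomial.coe_mul, coe_C, coe_X]
    have := hL i
    rw [hp i (ne_of_mem_erase hi), PowerSeries.derivative_coe] at this
    rw [this]; ring
  obtain ⟨R, hR⟩ := hR
  set l : ℂ[X] := 1 - C q * X with hl
  have hW' := congrArg (derivative ℂ) hW
  rw [Derivation.leibniz, PowerSeries.derivative_coe, PowerSeries.derivative_coe, smul_eq_mul,
    smul_eq_mul] at hW'
  have hdl : Polynomial.derivative l = - C q := by simp [hl]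
  rw [hdl] at hW'
  have key : ((l * W * Q : ℂ[X]) : PowerSeries ℂ) * (∑ i, PowerSeries.C (c i) * F i) =
      (((X * l * Polynomial.derivative W + C q * X * W) * Q + l * W * R : ℂ[X]) : PowerSeries ℂ) := by
    rw [← add_sum_erase univ _ (mem_univ i0), hc]
    simp only [Polynomial.coe_mul, Polynomial.coe_add, coe_C, coe_X, map_one, one_mul]
    have hneg : ((-C q : ℂ[X]) : PowerSeries ℂ) = - PowerSeries.C q := by
      rw [← C_neg, coe_C, map_neg]
    rw [hneg] at hW'
    have e0 := hL i0
    rw [← hR, ← hW', ← hW]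
    linear_combination (-(l : PowerSeries ℂ) * (l : PowerSeries ℂ) * Q) * e0
  have := eval_mul_ps _ _ _ q⁻¹ key hs (by simp [hl0])
  simp [hl0, hq, hW0, hQ0] at this
end PS

section DirichletThm

lemma sum_chars {R : Type*} [CommRing R] [Finite R] [Fintype (MulChar R ℂ)] (a : R) :
    ∑ χ : MulChar R ℂ, χ a = if a = 1 then (Fintype.card (MulChar R ℂ) : ℂ) else 0 := by
  split_ifs with ha
  · simp [ha]
  · have : NeZero (Monoid.exponent Rˣ) := ⟨Monoid.exponent_ne_zero_of_finite⟩
    obtain ⟨χ, hχ⟩ := MulChar.exists_apply_ne_one_of_hasEnoughRootsOfUnity R ℂ ha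
    refine eq_zero_of_mul_eq_self_left hχ ?_
    simp only [Finset.mul_sum, ← MulChar.mul_apply]
    exact Fintype.sum_bijective _ (Group.mulLeft_bijective χ) _ _ fun χ' ↦ rfl

abbrev Q (K : Type*) [Field K] (N : ℕ) := AdjoinRoot (X ^ N : K[X])

def psi {N : ℕ} (χ : MulChar (Q K N) ℂ) : K[X] →* ℂ :=
  χ.toMonoidHom.comp (AdjoinRoot.mk (X ^ N : K[X]) : K[X] →* Q K N)

lemma psi_apply {N : ℕ} (χ : MulChar (Q K N) ℂ) (f : K[X]) :
    psi χ f = χ (AdjoinRoot.mk (X ^ N) f) := rfl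

instance finQ (N : ℕ) : Finite (Q K N) := by
  have := (AdjoinRoot.powerBasis' (monic_X_pow (R := K) N)).finite
  exact Module.finite_of_finite K

lemma unit_mk {N : ℕ} {f : K[X]} (hf : f.coeff 0 ≠ 0) : IsUnit (AdjoinRoot.mk (X ^ N) f) := by
  have h1 : IsCoprime (X ^ N : K[X]) f := by
    apply IsCoprime.pow_left
    exact (irreducible_X.coprime_iff_not_dvd).2 (by rwa [X_dvd_iff])
  obtain ⟨a, b, hab⟩ := h1
  have := congrArg (AdjoinRoot.mk (X ^ N : K[X])) hab
  rw [map_add, map_mul, map_mul, AdjoinRoot.mk_self, mul_zero, zero_add, map_one] at this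
  exact IsUnit.of_mul_eq_one_right _ this

lemma sum_Mon {N d : ℕ} [Fintype (Q K N)] (hd : N ≤ d) (h : Q K N → ℂ) :
    ∑ f ∈ Mon K d, h (AdjoinRoot.mk (X ^ N) f) = (Fintype.card K : ℂ) ^ (d - N) * ∑ r, h r := by
  have hm := monic_X_pow (R := K) N
  have hrep : ∀ r : Q K N, (AdjoinRoot.modByMonicHom hm r).degree < N := by
    intro r
    obtain ⟨f, rfl⟩ := AdjoinRoot.mk_surjective r
    rw [AdjoinRoot.modByMonicHom_mk]
    simpa using degree_modByMonic_lt f hm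
  have : (Fintype.card K : ℂ) ^ (d - N) * ∑ r, h r =
      ∑ x ∈ Mon K (d - N) ×ˢ (univ : Finset (Q K N)), h x.2 := by
    rw [sum_product]
    simp only [sum_const, card_Mon, nsmul_eq_mul, Nat.cast_pow]
  rw [this]
  symm
  have hdeg : ∀ g : K[X], g ∈ Mon K (d - N) → ∀ r : Q K N,
      (AdjoinRoot.modByMonicHom hm r).degree < (X ^ N * g).degree := by
    intro g hg r
    obtain ⟨h1, h2⟩ := mem_Mon.1 hg
    refine (hrep r).trans_le ?_
    rw [degree_mul, degree_X_pow, degree_eq_natDegree h1.ne_zero]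
    exact_mod_cast Nat.le_add_right _ _
  apply Finset.sum_bij (fun x _ => X ^ N * x.1 + AdjoinRoot.modByMonicHom hm x.2)
  · rintro ⟨g, r⟩ hx
    have hg := (mem_product.1 hx).1
    obtain ⟨h1, h2⟩ := mem_Mon.1 hg
    refine mem_Mon.2 ⟨(hm.mul h1).add_of_left (hdeg g hg r), ?_⟩
    rw [natDegree_add_eq_left_of_degree_lt (hdeg g hg r), hm.natDegree_mul h1, natDegree_X_pow, h2]
    lia
  · rintro ⟨g, r⟩ hx ⟨g', r'⟩ hx' heq
    have h2 := congrArg (AdjoinRoot.mk (X ^ N : K[X])) heq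
    simp only [map_add, map_mul, AdjoinRoot.mk_self, zero_mul, zero_add,
      AdjoinRoot.mk_leftInverse hm _] at h2
    subst h2
    have h3 := mul_left_cancel₀ hm.ne_zero (add_right_cancel heq)
    exact Prod.ext h3 rfl
  · intro f hf
    obtain ⟨h1, h2⟩ := mem_Mon.1 hf
    refine ⟨(f /ₘ X ^ N, AdjoinRoot.mk _ f), ?_, ?_⟩
    · refine mem_product.2 ⟨mem_Mon.2 ⟨?_, ?_⟩, mem_univ _⟩
      · rw [Monic, leadingCoeff_divByMonic_of_monic hm]
        · exact h1
        · rw [degree_X_pow, degree_eq_natDegree h1.ne_zero, h2]; exact_mod_cast hd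
      · rw [natDegree_divByMonic f hm, h2, natDegree_X_pow]
    · simp only [AdjoinRoot.modByMonicHom_mk]
      rw [add_comm, modByMonic_add_div]
  · rintro ⟨g, r⟩ hx
    simp only [map_add, map_mul, AdjoinRoot.mk_self, zero_mul, zero_add,
      AdjoinRoot.mk_leftInverse hm _]

lemma sum_lam {N : ℕ} [Fintype (MulChar (Q K N) ℂ)] (v : Q K N) (n : ℕ) :
    ∑ χ : MulChar (Q K N) ℂ, χ v * lam (psi χ) n =
    ∑ x ∈ (Irr K n ×ˢ Icc 1 n) with x.2 * x.1.natDegree = n ∧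
        v * AdjoinRoot.mk (X ^ N) (x.1 ^ x.2) = 1,
      (x.1.natDegree : ℂ) * (Fintype.card (MulChar (Q K N) ℂ) : ℂ) := by
  simp only [lam, mul_sum]
  rw [sum_comm, sum_filter]
  refine sum_congr rfl fun x _ => ?_
  by_cases h : x.2 * x.1.natDegree = n
  · simp only [h, if_true, true_and, psi_apply]
    have : ∀ χ : MulChar (Q K N) ℂ, χ v * ((x.1.natDegree : ℂ) * χ (AdjoinRoot.mk (X ^ N) (x.1 ^ x.2)))
        = (x.1.natDegree : ℂ) * χ (v * AdjoinRoot.mk (X ^ N) (x.1 ^ x.2)) := by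
      intro χ; rw [map_mul]; ring
    rw [sum_congr rfl fun χ _ => this χ, ← mul_sum, sum_chars]
    split_ifs <;> simp
  · simp [h]

lemma summ (c s : ℝ) (hs0 : 0 < s) (hs1 : s < 1) :
    Summable fun n : ℕ => c * ((n : ℝ) ^ 1 * s ^ n) := by
  have h : ‖s‖ < 1 := by rw [Real.norm_of_nonneg hs0.le]; exact hs1
  have h2 := summable_pow_mul_geometric_of_norm_lt_one 1 h
  exact h2.mul_left c

lemma A_zero (ψ : K[X] →* ℂ) : A ψ 0 = 1 := by
  have : Mon K 0 = {1} := by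
    ext f
    rw [mem_Mon, mem_singleton]
    constructor
    · rintro ⟨h1, h2⟩; exact h1.natDegree_eq_zero.1 h2
    · rintro rfl; exact ⟨monic_one, natDegree_one⟩
  rw [A, this, sum_singleton, map_one]

open scoped ComplexOrder in
set_option maxHeartbeats 2000000 in
theorem dirichlet (N : ℕ) (u : Q K N) (hu : IsUnit u) :
    ∃ P : K[X], P.Monic ∧ Irreducible P ∧ AdjoinRoot.mk (X ^ N) P = u := by
  by_contra hno
  push Not at hno
  have : Fintype (Q K N) := Fintype.ofFinite _
  have : Fintype (MulChar (Q K N) ℂ) := Fintype.ofFinite _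
  obtain ⟨v, hv⟩ := hu.exists_right_inv
  have hvu : IsUnit v := IsUnit.of_mul_eq_one_right _ hv
  set q := Fintype.card K with hq
  have hq1 : 1 < q := Fintype.one_lt_card
  set G := Fintype.card (MulChar (Q K N) ℂ) with hG
  have hGpos : 0 < G := Fintype.card_pos
  have hAlarge : ∀ (χ : MulChar (Q K N) ℂ) d, N ≤ d → A (psi χ) d = (q : ℂ) ^ (d - N) * ∑ r, χ r :=
    fun χ d hd => sum_Mon hd χ
  let L : MulChar (Q K N) ℂ → PowerSeries ℂ := fun χ => PowerSeries.mk (A (psi χ))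
  let F : MulChar (Q K N) ℂ → PowerSeries ℂ := fun χ => PowerSeries.mk (lam (psi χ))
  let p : MulChar (Q K N) ℂ → ℂ[X] := fun χ => (L χ).trunc N
  have hFsum : ∀ (w : Q K N) n, PowerSeries.coeff n (∑ χ, PowerSeries.C (χ w) * F χ) =
      ∑ χ : MulChar (Q K N) ℂ, χ w * lam (psi χ) n := by
    intro w n
    rw [map_sum]
    refine sum_congr rfl fun χ _ => ?_
    rw [PowerSeries.coeff_C_mul, PowerSeries.coeff_mk]
  have hFsum1 : ∀ n, PowerSeries.coeff n (∑ χ, F χ) =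
      ∑ χ : MulChar (Q K N) ℂ, χ 1 * lam (psi χ) n := by
    intro n
    rw [← hFsum]
    congr 1
    refine sum_congr rfl fun χ _ => by simp
  refine main_ps (1 : MulChar (Q K N) ℂ) (q : ℂ) (by exact_mod_cast (by lia : q ≠ 0)) L F
    ?_ ?_ p ?_ ((1 - C (q : ℂ) * X) * p 1 + C (∑ r, (1 : MulChar (Q K N) ℂ) r) * X ^ N)
    ?_ ?_ ?_ ?_ (fun χ => χ v) (MulChar.one_apply hvu) ?_
  · intro χ
    ext n
    rw [PowerSeries.coeff_mul n (F χ)]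
    simp only [F, L, PowerSeries.coeff_mk]
    rw [← recur]
    cases n with
    | zero => simp
    | succ k =>
      rw [PowerSeries.coeff_succ_X_mul, PowerSeries.coeff_derivative, PowerSeries.coeff_mk]
      push_cast; ring
  · intro χ
    rw [← PowerSeries.coeff_zero_eq_constantCoeff_apply, PowerSeries.coeff_mk, A_zero]
  · intro χ hχ
    ext n
    rw [Polynomial.coeff_coe, PowerSeries.coeff_trunc]
    split_ifs with h
    · rfl
    · rw [PowerSeries.coeff_mk, hAlarge χ n (by lia), MulChar.sum_eq_zero_of_ne_one hχ, mul_zero]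
  · set c := ∑ r, (1 : MulChar (Q K N) ℂ) r with hc
    have hL1 : L 1 = (p 1 : PowerSeries ℂ) +
        PowerSeries.C c * PowerSeries.X ^ N * PowerSeries.mk (fun n => (q : ℂ) ^ n) := by
      ext n
      rw [map_add, mul_assoc, PowerSeries.coeff_C_mul, PowerSeries.coeff_X_pow_mul',
        Polynomial.coeff_coe, PowerSeries.coeff_trunc]
      by_cases h : n < N
      · rw [if_pos h, if_neg (by lia), mul_zero, add_zero]
      · rw [if_neg h, if_pos (by lia), PowerSeries.coeff_mk, PowerSeries.coeff_mk,
          hAlarge 1 n (by lia)]; ring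
    have hgeom : ((1 - C (q : ℂ) * X : ℂ[X]) : PowerSeries ℂ) *
        PowerSeries.mk (fun n => (q : ℂ) ^ n) = 1 := by
      rw [Polynomial.coe_sub, Polynomial.coe_mul, Polynomial.coe_C, Polynomial.coe_X,
        Polynomial.coe_one, sub_mul, one_mul, mul_assoc]
      ext n
      rw [map_sub, PowerSeries.coeff_C_mul]
      cases n with
      | zero => simp
      | succ k =>
        rw [PowerSeries.coeff_succ_X_mul, PowerSeries.coeff_mk, PowerSeries.coeff_mk,
          PowerSeries.coeff_one, if_neg (by lia)]; ring
    rw [hL1, Polynomial.coe_add, Polynomial.coe_mul, Polynomial.coe_mul, Polynomial.coe_C,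
      Polynomial.coe_pow, Polynomial.coe_X]
    linear_combination (PowerSeries.C c * PowerSeries.X ^ N) * hgeom
  · have hq0 : (q : ℂ) ≠ 0 := by exact_mod_cast (by lia : q ≠ 0)
    have hc : ∑ r, (1 : MulChar (Q K N) ℂ) r ≠ 0 := by
      rw [MulChar.sum_one_eq_card_units]
      exact_mod_cast Fintype.card_ne_zero
    rw [eval_add, eval_mul, eval_mul, eval_C, eval_pow, eval_X, eval_sub, eval_one, eval_mul,
      eval_C, eval_X, mul_inv_cancel₀ hq0, sub_self, zero_mul, zero_add]
    exact mul_ne_zero hc (pow_ne_zero _ (inv_ne_zero hq0))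
  · intro n
    rw [hFsum1, sum_lam]
    refine sum_nonneg fun x _ => ?_
    rw [← Nat.cast_mul]; exact Nat.cast_nonneg _
  · intro M
    have hX : IsUnit (AdjoinRoot.mk (X ^ N) (X - C 1 : K[X])) := unit_mk (by simp)
    set n := Nat.card (Q K N)ˣ * (M + 1) with hn
    have hcpos : 0 < Nat.card (Q K N)ˣ := Nat.card_pos
    have hn1 : M + 1 ≤ n := Nat.le_mul_of_pos_left _ hcpos
    refine ⟨n, by lia, ?_⟩
    rw [hFsum1, sum_lam]
    refine sum_pos' (fun x _ => by rw [← Nat.cast_mul]; exact Nat.cast_nonneg _) ⟨(X - C 1, n), ?_, ?_⟩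
    · refine mem_filter.2 ⟨mem_product.2 ⟨mem_Irr.2 ⟨monic_X_sub_C 1, irreducible_X_sub_C 1, ?_⟩,
        mem_Icc.2 ⟨by lia, le_rfl⟩⟩, ?_, ?_⟩
      · rw [natDegree_X_sub_C]; lia
      · simp only [natDegree_X_sub_C, mul_one]
      · obtain ⟨w, hw⟩ := hX
        rw [one_mul, map_pow, ← hw, ← Units.val_pow_eq_pow_val, hn, pow_mul, pow_card_eq_one']
        simp
    · simp only [natDegree_X_sub_C, Nat.cast_one, one_mul]
      exact_mod_cast hGpos
  · have hq0 : (0 : ℝ) < q := by exact_mod_cast (by lia : 0 < q)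
    have hbound : ∀ n, ‖∑ χ : MulChar (Q K N) ℂ, χ v * lam (psi χ) n‖ ≤
        (q : ℝ) ^ (n / 2 + 1) * (n * G) := by
      intro n
      rw [sum_lam]
      refine (norm_sum_le _ _).trans ?_
      refine (sum_le_card_nsmul _ _ ((n : ℝ) * G) ?_).trans ?_
      · intro x hx
        have hx' := mem_Irr.1 (mem_product.1 (mem_filter.1 hx).1).1
        rw [norm_mul, Complex.norm_natCast, Complex.norm_natCast]
        gcongr
        exact hx'.2.2
      · rw [nsmul_eq_mul]
        refine mul_le_mul_of_nonneg_right ?_ (by positivity)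
        rw [hq, ← Nat.cast_pow, ← card_Le]
        refine Nat.cast_le.2 (card_le_card_of_injOn Prod.fst ?_ ?_)
        · intro x hx
          obtain ⟨hx1, hx2, hx3⟩ := mem_filter.1 hx
          obtain ⟨hxI, hxj⟩ := mem_product.1 hx1
          obtain ⟨hm, hi, hdeg⟩ := mem_Irr.1 hxI
          have hj := mem_Icc.1 hxj
          have hj2 : x.2 ≠ 1 := by
            intro h1
            rw [h1, pow_one] at hx3
            refine hno x.1 hm hi ?_
            calc AdjoinRoot.mk (X ^ N) x.1 = (u * v) * AdjoinRoot.mk (X ^ N) x.1 := by rw [hv, one_mul]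
              _ = u * (v * AdjoinRoot.mk (X ^ N) x.1) := by ring
              _ = u := by rw [hx3, mul_one]
          have hle : x.1.natDegree ≤ n / 2 := by
            rw [Nat.le_div_iff_mul_le two_pos]
            have : 2 ≤ x.2 := by lia
            nlinarith
          exact mem_coe.2 ((Set.Finite.mem_toFinset _).2 hle)
        · intro x hx y hy hxy
          obtain ⟨hx1, hx2, hx3⟩ := mem_filter.1 hx
          obtain ⟨hy1, hy2, hy3⟩ := mem_filter.1 hy
          have hpos := (mem_Irr.1 (mem_product.1 hx1).1).2.1.natDegree_pos
          refine Prod.ext hxy ?_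
          have : x.2 * x.1.natDegree = y.2 * x.1.natDegree := by rw [hx2, hxy, hy2]
          exact Nat.eq_of_mul_eq_mul_right hpos this
    set s : ℝ := (Real.sqrt q)⁻¹ with hs
    have hsq : 1 < Real.sqrt q := by
      rw [Real.lt_sqrt zero_le_one]; simpa using hq1
    have hs1 : s < 1 := inv_lt_one_of_one_lt₀ hsq
    have hs0 : 0 < s := by positivity
    have hss : (q : ℝ)⁻¹ = s ^ 2 := by
      rw [hs, inv_pow, Real.sq_sqrt hq0.le]
    have hsum := summ (q * G : ℝ) s hs0 hs1
    refine Summable.of_nonneg_of_le (fun n => norm_nonneg _) (fun n => ?_) hsum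
    rw [hFsum, norm_mul, norm_pow, norm_inv, Complex.norm_natCast]
    refine (mul_le_mul_of_nonneg_right (hbound n) (by positivity)).trans ?_
    have hpw : (q : ℝ) ^ (n / 2) * (q : ℝ)⁻¹ ^ n ≤ s ^ n := by
      have h1 : (q : ℝ) ^ (n / 2) * (q : ℝ)⁻¹ ^ n = s ^ (2 * (n - n / 2)) := by
        have : n = n / 2 + (n - n / 2) := by lia
        conv_lhs => rw [show (q : ℝ)⁻¹ ^ n = (q : ℝ)⁻¹ ^ (n / 2) * (q : ℝ)⁻¹ ^ (n - n / 2) by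
          rw [← pow_add, ← this]]
        rw [← mul_assoc, ← mul_pow, mul_inv_cancel₀ hq0.ne', one_pow, one_mul, hss, pow_mul]
      rw [h1]
      exact pow_le_pow_of_le_one hs0.le hs1.le (by lia)
    calc (q : ℝ) ^ (n / 2 + 1) * (n * G) * (q : ℝ)⁻¹ ^ n
        = (q * G * n : ℝ) * ((q : ℝ) ^ (n / 2) * (q : ℝ)⁻¹ ^ n) := by ring
      _ ≤ (q * G * n : ℝ) * s ^ n := by gcongr
      _ = (q * G : ℝ) * ((n : ℝ) ^ 1 * s ^ n) := by ring

lemma exists_irr (m : ℕ) (a : ℕ → K) (h0 : a 0 ≠ 0) :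
    ∃ p : K[X], Irreducible p ∧ ∀ i ≤ m, p.coeff i = a i := by
  set p0 : K[X] := ∑ i ∈ range (m + 1), monomial i (a i) with hp0
  have hc : ∀ i ≤ m, p0.coeff i = a i := by
    intro i hi
    rw [hp0, finsetSum_coeff]
    simp only [coeff_monomial]
    rw [sum_ite_eq', if_pos (mem_range.2 (by lia))]
  obtain ⟨P, -, hi, hP⟩ := dirichlet (m + 1) (AdjoinRoot.mk (X ^ (m + 1)) p0)
    (unit_mk (by rwa [hc 0 (Nat.zero_le _)]))
  refine ⟨P, hi, fun i him => ?_⟩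
  have := X_pow_dvd_iff.1 (AdjoinRoot.mk_eq_mk.1 hP) i (by lia)
  rw [coeff_sub, sub_eq_zero] at this
  rw [this, hc i him]

end DirichletThm
end
end Dir


/-- Let `K` be a finite field and `a_0, …, a_m ∈ K` with `a_0 ≠ 0`. Then there are
infinitely many irreducible polynomials in `K[X]` whose coefficient at `X^i`
equals `a_i` for all `i ∈ [0, m]` (equivalently, for infinitely many tuples
`(n, a_{m+1}, …, a_n)` the polynomial `Σ_{i=0}^n a_i X^i` is irreducible). -/
theorem stmt7 (K : Type*) [Field K] [Fintype K] (m : ℕ) (a : ℕ → K) (h0 : a 0 ≠ 0) :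
    {p : Polynomial K | Irreducible p ∧ ∀ i : ℕ, i ≤ m → p.coeff i = a i}.Infinite := by
  intro hfin
  obtain ⟨D, hD⟩ := (hfin.image Polynomial.natDegree).bddAbove
  set M := max m D + 1 with hM
  obtain ⟨p, hp, hc⟩ := Dir.exists_irr M (fun i => if i ≤ m then a i else 1) (by simpa using h0)
  have h1 : p.natDegree ≤ D := by
    apply hD
    refine ⟨p, ⟨hp, fun i hi => ?_⟩, rfl⟩
    rw [hc i (by lia), if_pos hi]
  have h2 := hc M le_rfl
  rw [if_neg (by lia), coeff_eq_zero_of_natDegree_lt (by lia)] at h2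
  exact zero_ne_one h2
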